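/- arXiv:1906.03162 — 2 statements merged into one kernel-verified Lean document; each statement's English description precedes it below -/
import Mathlib

section
/- For every pair of exceptional vectors e₁, e₂ ∈ C with e₁·e₂ = 1, there are exactly 60 elements f ∈ C with e₁·f = 1 and e₂·f = 1, and exactly 32 elements f ∈ C with e₁·f = 1 and e₂·f = 0. -/
/-- The bilinear form on `Λ = ℤ⁹`: `d·e = d₀e₀ − Σ_{i=1}^{8} dᵢeᵢ`. -/
def dot (d e : Fin 9 → ℤ) : ℤ := d 0 * e 0 - ∑ i : Fin 8, d i.succ * e i.succ

/-- The canonical class `K = (−3, 1, 1, 1, 1, 1, 1, 1, 1)`. -/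
def KK : Fin 9 → ℤ := ![-3, 1, 1, 1, 1, 1, 1, 1, 1]

/-- A vector is exceptional if `d·d = −1` and `d·K = −1`. -/
def IsExceptional (d : Fin 9 → ℤ) : Prop := dot d d = -1 ∧ dot d KK = -1

/-- Integer lists of length `n`, with entries in `[-3, 1]`, sum `s` and sum of squares `q`;
branches violating the Cauchy–Schwarz inequality are pruned. -/
def boundedLists : ℕ → ℤ → ℤ → List (List ℤ)
  | 0, s, q => if s = 0 ∧ q = 0 then [[]] else []
  | n + 1, s, q =>
    if s * s ≤ (n + 1) * q then
      [-3, -2, -1, 0, 1].flatMap fun x =>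
        (boundedLists n (s - x) (q - x * x)).map (x :: ·)
    else []

/-- The coordinate lists of the exceptional vectors. -/
def exceptionalLists : List (List ℤ) :=
  [-1, 0, 1, 2, 3, 4, 5, 6, 7].flatMap fun x =>
    (boundedLists 8 (1 - 3 * x) (x * x + 1)).map (x :: ·)

/-- The sum of the products of corresponding entries. -/
def listInner : List ℤ → List ℤ → ℤ
  | a :: l, b :: m => a * b + listInner l m
  | _, _ => 0

/-- The form `dot` on coordinate lists. -/
def listDot : List ℤ → List ℤ → ℤ
  | a :: l, b :: m => a * b - listInner l m
  | _, _ => 0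

/-- The last standard basis vector, as a coordinate list. -/
def lastList : List ℤ := [0, 0, 0, 0, 0, 0, 0, 0, 1]

/-- The vector with a given coordinate list. -/
def listToVec (l : List ℤ) : Fin 9 → ℤ := fun i => l.getD i 0

theorem nodup_exceptionalLists : exceptionalLists.Nodup := by
  have h : exceptionalLists.IsChain (· < ·) := by decide +kernel
  exact (List.isChain_iff_pairwise.1 h).imp ne_of_lt

theorem exceptionalLists_spec : ∀ l ∈ exceptionalLists,
    l.length = 9 ∧ listDot l l = -1 ∧ listDot l [-3, 1, 1, 1, 1, 1, 1, 1, 1] = -1 := by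
  decide +kernel

theorem exists_orthogonal_of_ne_three : ∀ l ∈ exceptionalLists, listDot l lastList ≠ 3 →
    ∃ m ∈ exceptionalLists, listDot m lastList = 0 ∧ listDot l m = 0 := by
  decide +kernel

theorem exists_orthogonal_ne_three : ∀ l ∈ exceptionalLists,
    ∃ m ∈ exceptionalLists, listDot l m = 0 ∧ listDot m lastList ≠ 3 := by
  decide +kernel

/-- The coordinate lists of the exceptional vectors pairing to `1` with `lastList`. -/
def neighborLists : List (List ℤ) := exceptionalLists.filter fun m => listDot lastList m = 1

theorem length_filter_neighborLists : ∀ l ∈ neighborLists,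
    (neighborLists.filter fun m => listDot l m = 1).length = 60 ∧
    (neighborLists.filter fun m => listDot l m = 0).length = 32 := by
  decide +kernel

theorem mem_boundedLists {n : ℕ} (f : Fin n → ℤ) (hf : ∀ i, -3 ≤ f i ∧ f i ≤ 1) :
    List.ofFn f ∈ boundedLists n (∑ i, f i) (∑ i, f i ^ 2) := by
  induction n with
  | zero => simp [boundedLists]
  | succ n ih =>
    have hcs : (∑ i, f i) * (∑ i, f i) ≤ ((n : ℤ) + 1) * ∑ i, f i ^ 2 := by
      simpa [sq] using sq_sum_le_card_mul_sum_sq (s := Finset.univ) (f := f)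
    have h0 : f 0 ∈ ([-3, -2, -1, 0, 1] : List ℤ) := by
      obtain ⟨h, h'⟩ := hf 0
      generalize f 0 = x at h h'
      interval_cases x <;> simp
    rw [boundedLists, if_pos hcs, List.mem_flatMap]
    refine ⟨f 0, h0, ?_⟩
    rw [List.ofFn_succ, List.mem_map]
    refine ⟨_, ?_, rfl⟩
    simpa [Fin.sum_univ_succ, sq] using ih (fun i => f i.succ) fun i => hf i.succ

theorem dot_add_left (d d' e : Fin 9 → ℤ) : dot (d + d') e = dot d e + dot d' e := by
  simp only [dot, Pi.add_apply, add_mul, Finset.sum_add_distrib]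
  ring

theorem dot_smul_left (c : ℤ) (d e : Fin 9 → ℤ) : dot (c • d) e = c * dot d e := by
  simp only [dot, Pi.smul_apply, smul_eq_mul, mul_assoc, ← Finset.mul_sum, mul_sub]

theorem dot_comm (d e : Fin 9 → ℤ) : dot d e = dot e d := by
  simp only [dot, mul_comm]

theorem dot_sub_left (d d' e : Fin 9 → ℤ) : dot (d - d') e = dot d e - dot d' e := by
  rw [sub_eq_add_neg, dot_add_left, ← neg_one_smul ℤ d', dot_smul_left]
  ring

theorem dot_add_right (d e e' : Fin 9 → ℤ) : dot d (e + e') = dot d e + dot d e' := by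
  rw [dot_comm, dot_add_left, dot_comm e, dot_comm e']

theorem dot_sub_right (d e e' : Fin 9 → ℤ) : dot d (e - e') = dot d e - dot d e' := by
  rw [dot_comm, dot_sub_left, dot_comm e, dot_comm e']

theorem dot_smul_right (c : ℤ) (d e : Fin 9 → ℤ) : dot d (c • e) = c * dot d e := by
  rw [dot_comm, dot_smul_left, dot_comm]

theorem IsExceptional.sum_sq {f : Fin 9 → ℤ} (hf : IsExceptional f) :
    ∑ i : Fin 8, f i.succ ^ 2 = f 0 * f 0 + 1 := by
  have h := hf.1
  simp only [dot, ← sq] at h ⊢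
  linarith

theorem IsExceptional.sum_eq {f : Fin 9 → ℤ} (hf : IsExceptional f) :
    ∑ i : Fin 8, f i.succ = 1 - 3 * f 0 := by
  have h : f 0 * -3 - ∑ i : Fin 8, f i.succ = -1 := by
    simpa [dot, KK, Fin.sum_univ_succ] using hf.2
  linarith

theorem IsExceptional.apply_zero_mem {f : Fin 9 → ℤ} (hf : IsExceptional f) :
    f 0 ∈ ([-1, 0, 1, 2, 3, 4, 5, 6, 7] : List ℤ) := by
  have h := sq_sum_le_card_mul_sum_sq (s := Finset.univ) (f := fun i : Fin 8 => f i.succ)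
  simp only [hf.sum_sq, hf.sum_eq, Finset.card_univ, Fintype.card_fin, Nat.cast_ofNat] at h
  have h₁ : -1 ≤ f 0 := by nlinarith
  have h₂ : f 0 ≤ 7 := by nlinarith
  generalize f 0 = x at h₁ h₂
  interval_cases x <;> simp

theorem IsExceptional.apply_succ_bounds {f : Fin 9 → ℤ} (hf : IsExceptional f) (i : Fin 8) :
    -3 ≤ f i.succ ∧ f i.succ ≤ 1 := by
  have h := sq_sum_le_card_mul_sum_sq (s := Finset.univ.erase i) (f := fun i : Fin 8 => f i.succ)
  have h₁ := Finset.add_sum_erase Finset.univ (fun i : Fin 8 => f i.succ) (Finset.mem_univ i)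
  have h₂ := Finset.add_sum_erase Finset.univ (fun i : Fin 8 => f i.succ ^ 2) (Finset.mem_univ i)
  simp only [hf.sum_sq, hf.sum_eq] at h₁ h₂
  rw [eq_sub_of_add_eq' h₁, eq_sub_of_add_eq' h₂, Finset.card_erase_of_mem (Finset.mem_univ i)] at h
  simp only [Finset.card_univ, Fintype.card_fin, Nat.add_one_sub_one, Nat.cast_ofNat] at h
  have key : (f i.succ + 1) ^ 2 ≤ 2 ^ 2 := by
    nlinarith [sq_nonneg (2 * f 0 + 3 * f i.succ - 3)]
  have := abs_le_of_sq_le_sq' key (by norm_num)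
  constructor <;> linarith

theorem IsExceptional.ofFn_mem {f : Fin 9 → ℤ} (hf : IsExceptional f) :
    List.ofFn f ∈ exceptionalLists := by
  rw [exceptionalLists, List.mem_flatMap]
  refine ⟨f 0, hf.apply_zero_mem, ?_⟩
  rw [List.ofFn_succ, List.mem_map]
  refine ⟨_, ?_, rfl⟩
  rw [← hf.sum_sq, ← hf.sum_eq]
  exact mem_boundedLists _ hf.apply_succ_bounds

theorem listDot_ofFn (d e : Fin 9 → ℤ) : listDot (List.ofFn d) (List.ofFn e) = dot d e := by
  simp [List.ofFn_succ, listDot, listInner, dot, Fin.sum_univ_succ]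

theorem listToVec_ofFn (f : Fin 9 → ℤ) : listToVec (List.ofFn f) = f := by
  ext i
  fin_cases i <;> rfl

theorem ofFn_listToVec {l : List ℤ} (hl : l.length = 9) : List.ofFn (listToVec l) = l := by
  apply List.ext_getElem
  · simp [hl]
  · intro i _ h
    simp only [List.getElem_ofFn, listToVec, List.getD_eq_getElem _ _ h]

theorem ofFn_listToVec_of_mem {l : List ℤ} (hl : l ∈ exceptionalLists) :
    List.ofFn (listToVec l) = l :=
  ofFn_listToVec (exceptionalLists_spec l hl).1

theorem isExceptional_listToVec {l : List ℤ} (hl : l ∈ exceptionalLists) :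
    IsExceptional (listToVec l) := by
  obtain ⟨-, h, h'⟩ := exceptionalLists_spec l hl
  have hK : List.ofFn KK = [-3, 1, 1, 1, 1, 1, 1, 1, 1] := by simp [KK, List.ofFn_succ]
  constructor
  · rw [← listDot_ofFn, ofFn_listToVec_of_mem hl, h]
  · rw [← listDot_ofFn, ofFn_listToVec_of_mem hl, hK, h']

theorem dot_listToVec {l m : List ℤ} (hl : l ∈ exceptionalLists) (hm : m ∈ exceptionalLists) :
    dot (listToVec l) (listToVec m) = listDot l m := by
  rw [← listDot_ofFn, ofFn_listToVec_of_mem hl, ofFn_listToVec_of_mem hm]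

/-- A count of exceptional vectors is the length of the corresponding sublist of
`exceptionalLists`. -/
theorem ncard_isExceptional_and (p : List ℤ → Bool) :
    {f : Fin 9 → ℤ | IsExceptional f ∧ p (List.ofFn f)}.ncard =
      (exceptionalLists.filter p).length := by
  have himage : {f : Fin 9 → ℤ | IsExceptional f ∧ p (List.ofFn f)} =
      listToVec '' {l | l ∈ exceptionalLists.filter p} := by
    ext f
    simp only [Set.mem_ofPred_eq, Set.mem_image, List.mem_filter]
    constructor
    · rintro ⟨hf, hp⟩
      exact ⟨_, ⟨hf.ofFn_mem, hp⟩, listToVec_ofFn f⟩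
    · rintro ⟨l, ⟨hl, hp⟩, rfl⟩
      exact ⟨isExceptional_listToVec hl, by rwa [ofFn_listToVec_of_mem hl]⟩
  have hinj : Set.InjOn listToVec {l | l ∈ exceptionalLists.filter p} := by
    intro l hl m hm h
    rw [← ofFn_listToVec_of_mem (List.mem_of_mem_filter hl), h,
      ofFn_listToVec_of_mem (List.mem_of_mem_filter hm)]
  rw [himage, hinj.ncard_image,
    ← List.toFinset_card_of_nodup (nodup_exceptionalLists.filter p), ← Set.ncard_coe_finset,
    List.coe_toFinset]

/-- The reflection in a vector `α`, which should satisfy `α·α = -2`. -/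
def reflection (α f : Fin 9 → ℤ) : Fin 9 → ℤ := f + dot α f • α

theorem reflection_reflection {α : Fin 9 → ℤ} (hα : dot α α = -2) (f : Fin 9 → ℤ) :
    reflection α (reflection α f) = f := by
  simp only [reflection, dot_add_right, dot_smul_right, hα]
  module

theorem dot_reflection_reflection {α : Fin 9 → ℤ} (hα : dot α α = -2) (f g : Fin 9 → ℤ) :
    dot (reflection α f) (reflection α g) = dot f g := by
  simp only [reflection, dot_add_right, dot_add_left, dot_smul_left, dot_smul_right, hα,
    dot_comm f α]
  ring

theorem IsExceptional.reflection {α f : Fin 9 → ℤ} (hf : IsExceptional f) (hα : dot α α = -2)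
    (hK : dot α KK = 0) : IsExceptional (reflection α f) := by
  refine ⟨by rw [dot_reflection_reflection hα, hf.1], ?_⟩
  rw [_root_.reflection, dot_add_left, dot_smul_left, hf.2, hK]
  ring

/-- The counting statement for all pairs with first member `e`. -/
def HasNeighborCounts (e : Fin 9 → ℤ) : Prop :=
  ∀ e' : Fin 9 → ℤ, IsExceptional e' → dot e e' = 1 →
    {f : Fin 9 → ℤ | IsExceptional f ∧ dot e f = 1 ∧ dot e' f = 1}.ncard = 60 ∧
    {f : Fin 9 → ℤ | IsExceptional f ∧ dot e f = 1 ∧ dot e' f = 0}.ncard = 32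

/-- The reflection in `e - e'` swaps `e` and `e'` when these are orthogonal. -/
theorem HasNeighborCounts.of_dot_eq_zero {e e' : Fin 9 → ℤ} (h : HasNeighborCounts e')
    (he : IsExceptional e) (he' : IsExceptional e') (h0 : dot e e' = 0) :
    HasNeighborCounts e := by
  intro g hg hge
  have hα : dot (e - e') (e - e') = -2 := by
    simp only [dot_sub_left, dot_sub_right, he.1, he'.1, h0, dot_comm e' e]
    norm_num
  have hK : dot (e - e') KK = 0 := by rw [dot_sub_left, he.2, he'.2, sub_self]
  have hswap : reflection (e - e') e = e' := by
    rw [reflection, dot_sub_left, he.1, dot_comm e' e, h0]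
    module
  have hcount (c : ℤ) : {f : Fin 9 → ℤ | IsExceptional f ∧ dot e f = 1 ∧ dot g f = c}.ncard =
      {f : Fin 9 → ℤ | IsExceptional f ∧ dot e' f = 1 ∧
        dot (reflection (e - e') g) f = c}.ncard := by
    have hinv : Function.Involutive (reflection (e - e')) := reflection_reflection hα
    rw [← Set.ncard_image_of_injective _ hinv.injective,
      Set.image_eq_preimage_of_inverse hinv.leftInverse hinv.rightInverse]
    congr 1
    ext f
    have hf : IsExceptional (reflection (e - e') f) ↔ IsExceptional f :=
      ⟨fun hf => by simpa only [hinv f] using hf.reflection hα hK, fun hf => hf.reflection hα hK⟩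
    have hd (d : Fin 9 → ℤ) :
        dot d (reflection (e - e') f) = dot (reflection (e - e') d) f := by
      rw [← dot_reflection_reflection hα, hinv f]
    simp only [Set.mem_preimage, Set.mem_ofPred_eq, hf, hd, hswap]
  rw [hcount, hcount]
  have hdot := dot_reflection_reflection hα e g
  rw [hswap, hge] at hdot
  exact h _ (hg.reflection hα hK) hdot

theorem lastList_mem : lastList ∈ exceptionalLists := by decide +kernel

theorem hasNeighborCounts_lastList : HasNeighborCounts (listToVec lastList) := by
  intro g hg hg1
  have hlast := ofFn_listToVec_of_mem lastList_mem
  have hmem : List.ofFn g ∈ neighborLists := by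
    rw [neighborLists, List.mem_filter, decide_eq_true_iff]
    exact ⟨hg.ofFn_mem, by rw [← hlast, listDot_ofFn, hg1]⟩
  have hcount (c : ℤ) :
      {f : Fin 9 → ℤ | IsExceptional f ∧ dot (listToVec lastList) f = 1 ∧ dot g f = c}.ncard =
        (neighborLists.filter fun m => listDot (List.ofFn g) m = c).length := by
    rw [neighborLists, List.filter_filter, ← ncard_isExceptional_and]
    congr 1
    ext f
    have h := listDot_ofFn (listToVec lastList) f
    rw [hlast] at h
    simp only [Set.mem_ofPred_eq, Bool.and_eq_true, decide_eq_true_iff, h, listDot_ofFn]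
    tauto
  rw [hcount, hcount]
  exact length_filter_neighborLists _ hmem

theorem hasNeighborCounts_of_ne_three {l : List ℤ} (hl : l ∈ exceptionalLists)
    (h3 : listDot l lastList ≠ 3) : HasNeighborCounts (listToVec l) := by
  obtain ⟨m, hm, hm0, hlm⟩ := exists_orthogonal_of_ne_three l hl h3
  have hm' := hasNeighborCounts_lastList.of_dot_eq_zero (isExceptional_listToVec hm)
    (isExceptional_listToVec lastList_mem) (by rw [dot_listToVec hm lastList_mem, hm0])
  exact hm'.of_dot_eq_zero (isExceptional_listToVec hl) (isExceptional_listToVec hm)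
    (by rw [dot_listToVec hl hm, hlm])

theorem IsExceptional.hasNeighborCounts {e : Fin 9 → ℤ} (he : IsExceptional e) :
    HasNeighborCounts e := by
  obtain ⟨m, hm, hem, h3⟩ := exists_orthogonal_ne_three _ he.ofFn_mem
  refine (hasNeighborCounts_of_ne_three hm h3).of_dot_eq_zero he (isExceptional_listToVec hm) ?_
  rw [← listDot_ofFn, ofFn_listToVec_of_mem hm, hem]

/-- For exceptional `e₁, e₂` with `e₁·e₂ = 1` there are exactly 60 exceptional `f` with
`e₁·f = 1 = e₂·f`, and exactly 32 exceptional `f` with `e₁·f = 1` and `e₂·f = 0`. -/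
theorem stmt_5 (e₁ e₂ : Fin 9 → ℤ) (h₁ : IsExceptional e₁) (h₂ : IsExceptional e₂)
    (h12 : dot e₁ e₂ = 1) :
    {f : Fin 9 → ℤ | IsExceptional f ∧ dot e₁ f = 1 ∧ dot e₂ f = 1}.ncard = 60 ∧
    {f : Fin 9 → ℤ | IsExceptional f ∧ dot e₁ f = 1 ∧ dot e₂ f = 0}.ncard = 32 :=
  h₁.hasNeighborCounts e₂ h₂ h12
end

section
/- Let e₁, e₂ ∈ C be exceptional vectors with e₁·e₂ = 3, and let f ∈ C be any exceptional vector. Then e₁·f = 1 if and only if e₂·f = 1, and e₁·f = 0 if and only if e₂·f = 2. -/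
theorem dot_add_left_s6 (a b c : Fin 9 → ℤ) : dot (a + b) c = dot a c + dot b c := by
  simp only [dot, Pi.add_apply, add_mul, Finset.sum_add_distrib]
  ring

theorem dot_smul_left_s6 (n : ℤ) (a b : Fin 9 → ℤ) : dot (n • a) b = n * dot a b := by
  simp only [dot, Pi.smul_apply, smul_eq_mul, mul_assoc, ← Finset.mul_sum]
  ring

theorem dot_add_right_s6 (a b c : Fin 9 → ℤ) : dot a (b + c) = dot a b + dot a c := by
  simp only [dot_comm a, dot_add_left_s6]

theorem dot_smul_right_s6 (n : ℤ) (a b : Fin 9 → ℤ) : dot a (n • b) = n * dot a b := by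
  simp only [dot_comm a, dot_smul_left_s6]

theorem dot_KK_KK : dot KK KK = 1 := by decide

theorem dot_KK_right (d : Fin 9 → ℤ) : dot d KK = -3 * d 0 - ∑ i : Fin 8, d i.succ := by
  simp only [dot, KK, Fin.sum_univ_succ]
  simp
  ring

/-- The form is anisotropic on the orthogonal complement of `K`. -/
theorem eq_zero_of_dot_self_eq_zero {w : Fin 9 → ℤ} (hw : dot w w = 0) (hK : dot w KK = 0) :
    w = 0 := by
  rw [dot_KK_right] at hK
  have hcs := sq_sum_le_card_mul_sum_sq (s := Finset.univ) (f := fun i : Fin 8 => w i.succ)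
  simp only [dot, ← sq] at hw
  simp only [Finset.card_univ, Fintype.card_fin, Nat.cast_ofNat] at hcs
  have hsum : ∑ i : Fin 8, w i.succ = -3 * w 0 := by linarith
  rw [hsum] at hcs
  have h0 : w 0 = 0 := pow_eq_zero_iff two_ne_zero |>.1 (by nlinarith [sq_nonneg (w 0)])
  have hs : ∑ i : Fin 8, w i.succ ^ 2 = 0 := by simpa [h0] using hw
  rw [Finset.sum_eq_zero_iff_of_nonneg fun i _ => sq_nonneg _] at hs
  funext i
  refine Fin.cases h0 (fun j => ?_) i
  exact pow_eq_zero_iff two_ne_zero |>.1 (hs j (Finset.mem_univ j))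

/-- Exceptional vectors with `e₁·e₂ = 3` satisfy `e₁ + e₂ = -2K`. -/
theorem IsExceptional.add_add_two_smul_KK {e₁ e₂ : Fin 9 → ℤ} (h₁ : IsExceptional e₁)
    (h₂ : IsExceptional e₂) (h12 : dot e₁ e₂ = 3) : e₁ + e₂ + (2 : ℤ) • KK = 0 := by
  apply eq_zero_of_dot_self_eq_zero <;>
    simp only [dot_add_left_s6, dot_add_right_s6, dot_smul_left_s6, dot_smul_right_s6, dot_comm KK e₁,
      dot_comm KK e₂, dot_comm e₂ e₁, h₁.1, h₁.2, h₂.1, h₂.2, h12, dot_KK_KK] <;>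
    norm_num

/-- For exceptional `e₁, e₂` with `e₁·e₂ = 3` and any exceptional `f`:
`e₁·f = 1 ↔ e₂·f = 1` and `e₁·f = 0 ↔ e₂·f = 2`. -/
theorem stmt_6 (e₁ e₂ f : Fin 9 → ℤ) (h₁ : IsExceptional e₁) (h₂ : IsExceptional e₂)
    (hf : IsExceptional f) (h12 : dot e₁ e₂ = 3) :
    (dot e₁ f = 1 ↔ dot e₂ f = 1) ∧ (dot e₁ f = 0 ↔ dot e₂ f = 2) := by
  have h := congrArg (dot f) (h₁.add_add_two_smul_KK h₂ h12)
  have hz : dot f 0 = 0 := by simp [dot]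
  rw [hz, dot_add_right_s6, dot_add_right_s6, dot_smul_right_s6, hf.2, dot_comm f, dot_comm f] at h
  omega
end
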